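/- (Subsidy for optimal policies.) Let ρ be an optimal policy, i.e., a policy with WCR(ρ) ≤ r_α, and let s_α = sup{ q·(k_α − p) : q ∈ [0,1], p ∈ [0,k_α], (1−α)·q·k_α − q·p·log q > r_α } (the supremum of the empty set being 0). Then there exists a pair (q,p) ∈ [0,1]×[0,v̄] such that ρ(q,p) ≥ q·p + s_α. -/

import Mathlib

open Real Set MeasureTheory

noncomputable section

/-- `V` is an inverse-demand function: antitone, upper-semicontinuous, with values in `[0, vbar]`. -/
def IsDemand (vbar : ℝ) (V : ℝ → ℝ) : Prop :=
  AntitoneOn V (Icc 0 1) ∧ UpperSemicontinuousOn V (Icc 0 1) ∧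
    ∀ z ∈ Icc (0:ℝ) 1, V z ∈ Icc 0 vbar

/-- `C` is a cost function: monotone increasing, lower-semicontinuous, nonnegative, `C 0 = 0`. -/
def IsCost (C : ℝ → ℝ) : Prop :=
  MonotoneOn C (Icc 0 1) ∧ LowerSemicontinuousOn C (Icc 0 1) ∧
    (∀ z ∈ Icc (0:ℝ) 1, 0 ≤ C z) ∧ C 0 = 0

/-- `(q, p)` is feasible under the inverse-demand function `V`. -/
def Feasible (vbar : ℝ) (V : ℝ → ℝ) (q p : ℝ) : Prop :=
  q ∈ Icc (0:ℝ) 1 ∧ p ∈ Icc (0:ℝ) vbar ∧ p ≤ V q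

/-- The social optimum `OPT(V, C)`. -/
def OPT (V C : ℝ → ℝ) : ℝ :=
  sSup { x | ∃ q ∈ Icc (0:ℝ) 1, x = (∫ z in (0:ℝ)..q, V z) - C q }

/-- `ρ` is a policy: upper-semicontinuous with `ρ 0 0 ≥ 0`. -/
def IsPolicy (vbar : ℝ) (ρ : ℝ → ℝ → ℝ) : Prop :=
  UpperSemicontinuousOn (fun x : ℝ × ℝ => ρ x.1 x.2) (Icc 0 1 ×ˢ Icc 0 vbar) ∧ 0 ≤ ρ 0 0

/-- `(q, p)` is a firm's best response to `(V, C)` under the policy `ρ`. -/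
def BestResponse (vbar : ℝ) (V C : ℝ → ℝ) (ρ : ℝ → ℝ → ℝ) (q p : ℝ) : Prop :=
  Feasible vbar V q p ∧
    ∀ q' p', Feasible vbar V q' p' → ρ q' p' - C q' ≤ ρ q p - C q

/-- The regret `RGRT = DSTR + (1 - α) * FP`. -/
def RGRT (vbar α : ℝ) (V C : ℝ → ℝ) (ρ : ℝ → ℝ → ℝ) (q p : ℝ) : ℝ :=
  (OPT V C - ((∫ z in (0:ℝ)..q, V z) - C q)) + (1 - α) * (ρ q p - C q)

/-- The worst-case regret of a policy `ρ` (as an extended real, since the supremum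
ranges over all demand/cost scenarios and best responses). -/
def WCR (vbar α : ℝ) (ρ : ℝ → ℝ → ℝ) : EReal :=
  sSup { r : EReal | ∃ V C q p, IsDemand vbar V ∧ IsCost C ∧
    BestResponse vbar V C ρ q p ∧ r = ((RGRT vbar α V C ρ q p : ℝ) : EReal) }

/-- The price-cap level `k_α = v̄ / (2 - α)`. -/
def kcap (vbar α : ℝ) : ℝ := vbar / (2 - α)

/-- The objective `min((1-α) q k_α - q p log q, q (k_α - p))`.
(Note `Real.log 0 = 0`, so `q * p * log q` is `0` at `q = 0` as required.) -/
def regretFn (vbar α q p : ℝ) : ℝ :=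
  min ((1 - α) * q * kcap vbar α - q * p * Real.log q) (q * (kcap vbar α - p))

/-- The lower bound `r_α` on the worst-case regret. -/
def rbound (vbar α : ℝ) : ℝ :=
  sSup { x | ∃ q ∈ Icc (0:ℝ) 1, ∃ p ∈ Icc (0:ℝ) (kcap vbar α), x = regretFn vbar α q p }

/-- The subsidy level `s_α`. (`Real.sSup ∅ = 0`, matching the convention for the empty set.) -/
def sbound (vbar α : ℝ) : ℝ :=
  sSup { x | ∃ q ∈ Icc (0:ℝ) 1, ∃ p ∈ Icc (0:ℝ) (kcap vbar α),
    (1 - α) * q * kcap vbar α - q * p * Real.log q > rbound vbar α ∧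
      x = q * (kcap vbar α - p) }


/-- The inverse-demand function equal to `v` on `[0, a]` and to the unit-elastic demand
`b / z` beyond `a`. -/
def unitElasticDemand (v a b z : ℝ) : ℝ := if z ≤ a then v else b / z

/-- The cost function with a fixed cost `c` and no marginal cost. -/
def fixedCost (c z : ℝ) : ℝ := if z = 0 then 0 else c

lemma isCost_fixedCost {c : ℝ} (hc : 0 ≤ c) : IsCost (fixedCost c) := by
  have nonneg : ∀ z, 0 ≤ fixedCost c z := fun z => by
    unfold fixedCost; split_ifs <;> simp [hc]
  refine ⟨?_, ?_, fun z _ => nonneg z, by simp [fixedCost]⟩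
  · intro x hx y hy hxy
    rcases eq_or_ne x 0 with rfl | hx0
    · simpa [fixedCost] using nonneg y
    · have hy0 : y ≠ 0 := ((lt_of_le_of_ne hx.1 hx0.symm).trans_le hxy).ne'
      simp [fixedCost, hx0, hy0]
  · intro x _ y hy
    rcases eq_or_ne x 0 with rfl | hx0
    · exact Filter.Eventually.of_forall fun z => lt_of_lt_of_le (by simpa [fixedCost] using hy)
        (nonneg z)
    · refine Filter.Eventually.filter_mono nhdsWithin_le_nhds ?_
      filter_upwards [isOpen_ne.mem_nhds hx0] with z hz
      have hz0 : z ≠ 0 := hz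
      simpa [fixedCost, hx0, hz0] using hy

lemma isDemand_unitElasticDemand {v a b : ℝ} (hv : 0 < v) (ha : 0 < a) (hb : 0 ≤ b)
    (hba : b ≤ a * v) : IsDemand v (unitElasticDemand v a b) := by
  have le_top : ∀ z, unitElasticDemand v a b z ≤ v := fun z => by
    unfold unitElasticDemand
    split_ifs with h
    · exact le_rfl
    · rw [div_le_iff₀ (by linarith)]; nlinarith
  refine ⟨?_, ?_, fun z hz => ⟨?_, le_top z⟩⟩
  · intro x _ y _ hxy
    by_cases hx : x ≤ a
    · simpa [unitElasticDemand, hx] using le_top y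
    · have hy : ¬ y ≤ a := by linarith
      have hx0 : 0 < x := by linarith
      simp only [unitElasticDemand, hx, hy, if_false]
      gcongr
  · intro x _ y hy
    rcases le_or_gt x a with hx | hx
    · have hy' : v < y := by simpa [unitElasticDemand, hx] using hy
      exact Filter.Eventually.of_forall fun z => (le_top z).trans_lt hy'
    · have hy' : b / x < y := by simpa [unitElasticDemand, hx.not_ge] using hy
      have hcont : ContinuousAt (fun z => b / z) x :=
        continuousAt_const.div continuousAt_id (by simp; linarith)
      refine Filter.Eventually.filter_mono nhdsWithin_le_nhds ?_
      filter_upwards [hcont.eventually_lt_const hy', lt_mem_nhds hx] with z hz haz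
      simpa [unitElasticDemand, haz.not_ge] using hz
  · unfold unitElasticDemand
    split_ifs
    · exact hv.le
    · exact div_nonneg hb hz.1

lemma integral_unitElasticDemand_of_le {v a b q : ℝ} (hq : 0 ≤ q) (hqa : q ≤ a) :
    ∫ z in (0:ℝ)..q, unitElasticDemand v a b z = q * v := by
  have : ∫ z in (0:ℝ)..q, unitElasticDemand v a b z = ∫ _ in (0:ℝ)..q, v := by
    refine intervalIntegral.integral_congr fun z hz => ?_
    rw [uIcc_of_le hq] at hz
    simp [unitElasticDemand, hz.2.trans hqa]
  simp [this]

lemma integral_unitElasticDemand_one {v a b : ℝ} (ha : 0 < a) (ha1 : a ≤ 1) :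
    ∫ z in (0:ℝ)..1, unitElasticDemand v a b z = a * v - b * Real.log a := by
  have tail : EqOn (fun z => b * z⁻¹) (unitElasticDemand v a b) (uIoc a 1) := fun z hz => by
    rw [uIoc_of_le ha1] at hz
    simp [unitElasticDemand, hz.1.not_ge, div_eq_mul_inv]
  have head : EqOn (fun _ => v) (unitElasticDemand v a b) (uIoc 0 a) := fun z hz => by
    rw [uIoc_of_le ha.le] at hz
    simp [unitElasticDemand, hz.2]
  have int_tail : IntervalIntegrable (fun z : ℝ => b * z⁻¹) volume a 1 :=
    (intervalIntegral.intervalIntegrable_inv (fun z hz => by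
      rw [uIcc_of_le ha1] at hz; exact (ha.trans_le hz.1).ne') continuousOn_id).const_mul b
  rw [← intervalIntegral.integral_add_adjacent_intervals
      ((intervalIntegrable_const (c := v)).congr head) (int_tail.congr tail),
    integral_unitElasticDemand_of_le ha.le le_rfl,
    ← intervalIntegral.integral_congr_ae (.of_forall fun z hz => tail hz), intervalIntegral.integral_const_mul,
    integral_inv_of_pos ha one_pos, one_div, Real.log_inv]
  ring

lemma le_OPT {v : ℝ} {V C : ℝ → ℝ} (hV : IsDemand v V) (hC : IsCost C) {q : ℝ}
    (hq : q ∈ Icc (0:ℝ) 1) : (∫ z in (0:ℝ)..q, V z) - C q ≤ OPT V C := by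
  refine le_csSup ⟨v, ?_⟩ ⟨q, hq, rfl⟩
  rintro _ ⟨x, hx, rfl⟩
  have bound : ‖∫ z in (0:ℝ)..x, V z‖ ≤ v * |x - 0| := by
    refine intervalIntegral.norm_integral_le_of_norm_le_const fun z hz => ?_
    rw [uIoc_of_le hx.1] at hz
    have := hV.2.2 z ⟨hz.1.le, hz.2.trans hx.2⟩
    rw [Real.norm_of_nonneg this.1]
    exact this.2
  have hv : 0 ≤ v := (hV.2.2 0 (by simp)).1.trans (hV.2.2 0 (by simp)).2
  rw [sub_zero, abs_of_nonneg hx.1] at bound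
  nlinarith [le_abs_self (∫ z in (0:ℝ)..x, V z), hC.2.2.1 x hx, hx.2,
    Real.norm_eq_abs (∫ z in (0:ℝ)..x, V z)]

lemma RGRT_le_of_WCR_le {v α r : ℝ} {ρ : ℝ → ℝ → ℝ} (h : WCR v α ρ ≤ (r : EReal))
    {V C : ℝ → ℝ} {q p : ℝ} (hV : IsDemand v V) (hC : IsCost C)
    (hbr : BestResponse v V C ρ q p) : RGRT v α V C ρ q p ≤ r :=
  by
  refine EReal.coe_le_coe_iff.1 (le_trans (le_sSup ?_) h)
  exact ⟨V, C, q, p, hV, hC, hbr, rfl⟩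

lemma feasible_unitElasticDemand_iff {v a b q p : ℝ} (ha : 0 < a) :
    Feasible v (unitElasticDemand v a b) q p ↔
      (q, p) ∈ (Icc (0:ℝ) 1 ×ˢ Icc 0 v) ∩ ({x | x.1 ≤ a} ∪ {x | a ≤ x.1 ∧ x.2 * x.1 ≤ b}) := by
  simp only [Feasible, unitElasticDemand, mem_inter_iff, mem_prod, mem_union, mem_ofPred_eq,
    and_assoc]
  refine and_congr_right fun _ => and_congr_right fun hp => ?_
  split_ifs with h
  · simp [h, hp.2]
  · rw [le_div_iff₀ (by linarith)]
    simp [h, (not_le.1 h).le]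

/-- If the policy `ρ` is always below the revenue `q * p` plus a subsidy of `a * (k - p₀)`, then
its worst-case regret is at least `(1 - α) * a * k - a * p₀ * log a`. -/
lemma le_of_WCR_le_of_lt_subsidy {v α r a p₀ : ℝ} {ρ : ℝ → ℝ → ℝ} (hv : 0 < v)
    (hα : α ∈ Icc (0:ℝ) 1) (hρ : IsPolicy v ρ) (hr : WCR v α ρ ≤ (r : EReal))
    (ha : a ∈ Ioc (0:ℝ) 1) (hp₀ : p₀ ∈ Icc (0:ℝ) (kcap v α))
    (hlt : ∀ q ∈ Icc (0:ℝ) 1, ∀ p ∈ Icc (0:ℝ) v, ρ q p < q * p + a * (kcap v α - p₀)) :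
    (1 - α) * a * kcap v α - a * p₀ * Real.log a ≤ r := by
  obtain ⟨ha0, ha1⟩ := ha
  set k := kcap v α with hk
  have hkv : (2 - α) * k = v := by
    rw [hk, kcap, mul_div_cancel₀]; linarith [hα.2]
  have hk0 : 0 ≤ k := hp₀.1.trans hp₀.2
  have hkle : k ≤ v := by nlinarith [hα.2]
  have hb : 0 ≤ a * p₀ := mul_nonneg ha0.le hp₀.1
  have hba : a * p₀ ≤ a * v := mul_le_mul_of_nonneg_left (hp₀.2.trans hkle) ha0.le
  set V := unitElasticDemand v a (a * p₀) with hVdef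
  have hV : IsDemand v V := isDemand_unitElasticDemand hv ha0 hb hba
  have hfeas := fun q p => feasible_unitElasticDemand_iff (v := v) (b := a * p₀) (q := q) (p := p) ha0
  set K := (Icc (0:ℝ) 1 ×ˢ Icc 0 v) ∩ ({x | x.1 ≤ a} ∪ {x | a ≤ x.1 ∧ x.2 * x.1 ≤ a * p₀})
  have hK : IsCompact K := by
    refine (isCompact_Icc.prod isCompact_Icc).inter_right (IsClosed.union ?_ ?_)
    · exact isClosed_le continuous_fst continuous_const
    · exact (isClosed_le continuous_const continuous_fst).inter
        (isClosed_le (continuous_snd.mul continuous_fst) continuous_const)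
  have hK0 : ((0, 0) : ℝ × ℝ) ∈ K := ⟨by simp [hv.le], Or.inl ha0.le⟩
  obtain ⟨⟨q, p⟩, hqp, hmax⟩ :=
    (hρ.1.mono inter_subset_left).exists_isMaxOn ⟨_, hK0⟩ hK
  have hmax' : ∀ q' p', Feasible v V q' p' → ρ q' p' ≤ ρ q p := fun q' p' h =>
    hmax ((hfeas q' p').1 h)
  have hR : 0 ≤ ρ q p := hρ.2.trans (hmax hK0)
  rcases le_or_gt (ρ q p) (a * k) with hle | hgt
  · -- A fixed cost equal to the maximal revenue keeps the firm out of the market.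
    have hC := isCost_fixedCost hR
    have hsub : Prod.mk (0 : ℝ) '' Icc 0 v ⊆ Icc (0:ℝ) 1 ×ˢ Icc 0 v := by
      rintro _ ⟨y, hy, rfl⟩; exact ⟨by simp, hy⟩
    obtain ⟨_, ⟨p', hp', rfl⟩, hmax0⟩ := (hρ.1.mono hsub).exists_isMaxOn
      ((nonempty_Icc.2 hv.le).image _) (isCompact_Icc.image (by fun_prop))
    have hmax0' : ∀ y ∈ Icc 0 v, ρ 0 y ≤ ρ 0 p' := fun y hy => hmax0 ⟨y, hy, rfl⟩
    have h0 : 0 ≤ ρ 0 p' := hρ.2.trans (hmax0' 0 (left_mem_Icc.2 hv.le))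
    have hbr : BestResponse v V (fixedCost (ρ q p)) ρ 0 p' := by
      refine ⟨(hfeas _ _).2 ⟨⟨by simp, hp'⟩, Or.inl ha0.le⟩, fun x y hxy => ?_⟩
      rcases eq_or_ne x 0 with rfl | hx
      · exact sub_le_sub_right (hmax0' y hxy.2.1) _
      · have := hmax' x y hxy
        simp only [fixedCost, hx, if_true, if_false]
        linarith
    have hreg := RGRT_le_of_WCR_le hr hV hC hbr
    have hopt := le_OPT hV hC (right_mem_Icc.2 zero_le_one)
    rw [hVdef, integral_unitElasticDemand_one ha0 ha1, ← hVdef] at hopt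
    have hcost0 : fixedCost (ρ q p) 0 = 0 := by simp [fixedCost]
    have hcost1 : fixedCost (ρ q p) 1 = ρ q p := by simp [fixedCost]
    simp only [RGRT, hcost0, hcost1, intervalIntegral.integral_same, sub_zero] at hreg hopt
    have := mul_nonneg (sub_nonneg.2 hα.2) h0
    have hav : a * v = (1 - α) * a * k + a * k := by rw [← hkv]; ring
    linarith
  · -- Without costs, the firm produces at most `a` and makes a large profit.
    have hC := isCost_fixedCost le_rfl
    have hzero : ∀ z, fixedCost 0 z = 0 := fun z => by simp [fixedCost]
    have hbr : BestResponse v V (fixedCost 0) ρ q p :=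
      ⟨(hfeas _ _).2 hqp, fun x y hxy => by simpa [hzero] using hmax' x y hxy⟩
    have hqa : q ≤ a := by
      rcases hqp.2 with h | h
      · exact h
      · have h1 := hlt q hqp.1.1 p hqp.1.2
        have h2 : p * q ≤ a * p₀ := h.2
        nlinarith
    have hreg := RGRT_le_of_WCR_le hr hV hC hbr
    have hopt := le_OPT hV hC (right_mem_Icc.2 zero_le_one)
    rw [hVdef, integral_unitElasticDemand_one ha0 ha1, ← hVdef] at hopt
    rw [RGRT, hVdef, integral_unitElasticDemand_of_le hqp.1.1.1 hqa, ← hVdef] at hreg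
    rw [hzero] at hreg hopt
    have := mul_le_mul_of_nonneg_left hgt.le (sub_nonneg.2 hα.2)
    have := mul_le_mul_of_nonneg_right hqa hv.le
    linarith


/-- **Theorem 3, subsidy.** Let `ρ` be an optimal policy (worst-case regret at
most `r_alpha`). Then there is a pair `(q, p) ∈ [0,1] × [0, vbar]` with
`ρ q p ≥ q * p + s_alpha`. -/
theorem optimal_policy_subsidy
    (vbar alpha : ℝ) (hv : 0 < vbar) (halpha : alpha ∈ Icc (0:ℝ) 1)
    (ρ : ℝ → ℝ → ℝ) (hρ : IsPolicy vbar ρ)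
    (hopt : WCR vbar alpha ρ ≤ ((rbound vbar alpha : ℝ) : EReal)) :
    ∃ q ∈ Icc (0:ℝ) 1, ∃ p ∈ Icc (0:ℝ) vbar, q * p + sbound vbar alpha ≤ ρ q p := by
  by_contra! hcon
  have hsquare : IsCompact (Icc (0:ℝ) 1 ×ˢ Icc 0 vbar) := isCompact_Icc.prod isCompact_Icc
  have husc : UpperSemicontinuousOn (fun x : ℝ × ℝ => ρ x.1 x.2 + -(x.1 * x.2))
      (Icc 0 1 ×ˢ Icc 0 vbar) :=
    hρ.1.add <| (by fun_prop : Continuous fun x : ℝ × ℝ => -(x.1 * x.2)).continuousOn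
      |>.upperSemicontinuousOn
  have hzero : ((0, 0) : ℝ × ℝ) ∈ Icc (0:ℝ) 1 ×ˢ Icc 0 vbar := by simp [hv.le]
  obtain ⟨⟨q, p⟩, ⟨hq, hp⟩, hmax⟩ := husc.exists_isMaxOn ⟨_, hzero⟩ hsquare
  have hM : ρ q p - q * p < sbound vbar alpha := by linarith [hcon q hq p hp]
  have hM0 : 0 ≤ ρ q p - q * p := by
    have : ρ 0 0 + -(0 * 0) ≤ ρ q p + -(q * p) := hmax hzero
    linarith [hρ.2]
  obtain ⟨_, ⟨a, ha, p₀, hp₀, hgt, rfl⟩, hlt⟩ := exists_lt_of_lt_csSup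
    (nonempty_iff_ne_empty.2 fun h => by
      rw [sbound, h, Real.sSup_empty] at hM; linarith) hM
  have ha0 : 0 < a := by
    refine lt_of_le_of_ne ha.1 ?_
    rintro rfl
    linarith
  refine hgt.not_ge (le_of_WCR_le_of_lt_subsidy hv halpha hρ hopt ⟨ha0, ha.2⟩ hp₀
    fun x hx y hy => ?_)
  have : ρ x y + -(x * y) ≤ ρ q p + -(q * p) := hmax (mk_mem_prod hx hy)
  linarith
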